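/- (Global ideal solvability) Let P be a topological space, f : P×ℝⁿ → ℝᵐ, R : P ⇉ ℝⁿ with nonempty closed values, and C : P ⇉ ℝᵐ with each C(p) a pointed closed convex cone satisfying {0} ≠ C(p) ⊊ ℝᵐ. Suppose that: (i) for every p ∈ P, the set f(p,R(p)) is closed and C(p)-bounded (i.e. f(p,R(p)) \ C(p) is bounded); (ii) α̲_{f,C,R} > 1; (iii) f(p,·) is continuous on ℝⁿ for every p ∈ P and Lipschitz continuous on ℝⁿ \ R(p) with a constant ℓ_f, 0 < ℓ_f < α̲_{f,C,R} − 1, uniform in p. Then the ideal efficient solution set IE(p) = {x ∈ R(p) : f(p,R(p)) − f(p,x) ⊆ C(p)} is nonempty for every p ∈ P, and for every α ∈ ((α̲_{f,C,R} − ℓ_f + 1)/2, α̲_{f,C,R} − ℓ_f) and every x₀ ∈ ℝⁿ it holds dist(x₀, IE(p)) ≤ [e(f(p,R(p)) − f(p,x₀), C(p)) + (α̲_{f,C,R} − α)·dist(x₀, R(p))] / (α̲_{f,C,R} − α − ℓ_f) for all p ∈ P. -/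

import Mathlib

open Set Metric EMetric ENNReal Pointwise Filter Topology

/-- Excess of `A` beyond `B`: `e(A,B) = ⨆ a ∈ A, dist(a,B)` in `[0,∞]`. -/
noncomputable def excess {Y : Type*} [PseudoEMetricSpace Y] (A B : Set Y) : ℝ≥0∞ :=
  ⨆ a ∈ A, EMetric.infEdist a B

/-- `C` is a closed convex cone (containing the origin). -/
def IsClosedConvexCone {Y : Type*} [SeminormedAddCommGroup Y] [NormedSpace ℝ Y]
    (C : Set Y) : Prop :=
  IsClosed C ∧ Convex ℝ C ∧ (0 : Y) ∈ C ∧ ∀ c ∈ C, ∀ t : ℝ, 0 ≤ t → t • c ∈ C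

/-- `a` is an admissible bound of metric `C`-increase of `G` at `x₀`. -/
def IsIncBoundAt {X Y : Type*} [PseudoMetricSpace X] [SeminormedAddCommGroup Y]
    (G : X → Set Y) (C : Set Y) (x₀ : X) (a : ℝ) : Prop :=
  1 < a ∧ ∃ δ : ℝ, 0 < δ ∧ ∀ r : ℝ, 0 < r → r ≤ δ →
    ∃ u ∈ Metric.closedBall x₀ r,
      Metric.cthickening (a * r) (G u) ⊆ Metric.cthickening r (G x₀ + C)

/-- `G` is metrically `C`-increasing at `x₀`. -/
def CIncreasingAt {X Y : Type*} [PseudoMetricSpace X] [SeminormedAddCommGroup Y]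
    (G : X → Set Y) (C : Set Y) (x₀ : X) : Prop :=
  ∃ a : ℝ, IsIncBoundAt G C x₀ a

/-- The exact bound of metric `C`-increase of `G` at `x₀` (in `[0,∞]`). -/
noncomputable def incBound {X Y : Type*} [PseudoMetricSpace X] [SeminormedAddCommGroup Y]
    (G : X → Set Y) (C : Set Y) (x₀ : X) : ℝ≥0∞ :=
  ⨆ a ∈ {a : ℝ | IsIncBoundAt G C x₀ a}, ENNReal.ofReal a

/-- Lower semicontinuity of a set-valued mapping. -/
def LscSV {P Y : Type*} [TopologicalSpace P] [TopologicalSpace Y] (G : P → Set Y) : Prop :=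
  ∀ p : P, ∀ A : Set Y, IsOpen A → (G p ∩ A).Nonempty →
    ∀ᶠ p' in nhds p, (G p' ∩ A).Nonempty

/-- Upper semicontinuity of a set-valued mapping. -/
def UscSV {P Y : Type*} [TopologicalSpace P] [TopologicalSpace Y] (G : P → Set Y) : Prop :=
  ∀ p : P, ∀ A : Set Y, IsOpen A → G p ⊆ A → ∀ᶠ p' in nhds p, G p' ⊆ A

/-- Hausdorff `C`-upper semicontinuity at a point. -/
def HausdorffCUscAt {P Y : Type*} [TopologicalSpace P] [SeminormedAddCommGroup Y]
    (G : P → Set Y) (C : Set Y) (p₀ : P) : Prop :=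
  ∀ ε : ℝ, 0 < ε → ∀ᶠ p in nhds p₀, G p ⊆ Metric.cthickening ε (G p₀ + C)

/-- `C`-concavity of a set-valued mapping. -/
def CConcave {X Y : Type*} [SeminormedAddCommGroup X] [NormedSpace ℝ X]
    [SeminormedAddCommGroup Y] [NormedSpace ℝ Y] (G : X → Set Y) (C : Set Y) : Prop :=
  ∀ x₁ x₂ : X, ∀ t : ℝ, t ∈ Set.Icc (0:ℝ) 1 →
    G (t • x₁ + (1 - t) • x₂) ⊆ t • G x₁ + (1 - t) • G x₂ + C

/-- A set is proximinal if the distance to it is attained from every point. -/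
def Proximinal {X : Type*} [PseudoMetricSpace X] (S : Set X) : Prop :=
  ∀ x : X, ∃ s ∈ S, dist x s = Metric.infDist x S

/-- Metric (Menger) convexity of a metric space. -/
def MetricallyConvex (X : Type*) [PseudoMetricSpace X] : Prop :=
  ∀ a b : X, a ≠ b → ∃ c : X, c ≠ a ∧ c ≠ b ∧ dist a b = dist a c + dist c b

/-- The constant `α_{F,C}` associated with a parameterized set-valued inclusion. -/
noncomputable def alphaFC {P X Y : Type*} [PseudoMetricSpace X] [SeminormedAddCommGroup Y]
    (F : P → X → Set Y) (Cm : P → Set Y) : ℝ≥0∞ :=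
  ⨅ q ∈ {q : P × X | ¬ (F q.1 q.2 ⊆ Cm q.1)}, incBound (F q.1) (Cm q.1) q.2

/-- The constant `α̃_{F,C,R}` associated with a constrained set-valued inclusion. -/
noncomputable def alphaTilde {P X Y : Type*} [PseudoMetricSpace X] [SeminormedAddCommGroup Y]
    (F : P → X → Set Y) (Cm : P → Set Y) (R : P → Set X) : ℝ≥0∞ :=
  ⨅ q ∈ {q : P × X | ¬ (F q.1 q.2 ⊆ Cm q.1) ∧ q.2 ∈ R q.1}, incBound (F q.1) (Cm q.1) q.2

/-- The exact bound of `C`-decrease of a single-valued map: `dec(g,C,x₀) = inc(−g,C,x₀)`. -/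
noncomputable def decBound {X Y : Type*} [PseudoMetricSpace X] [SeminormedAddCommGroup Y]
    (g : X → Y) (C : Set Y) (x₀ : X) : ℝ≥0∞ :=
  incBound (fun x => ({-g x} : Set Y)) C x₀

/-- `g` is `C`-decreasing at `x₀` iff `−g` is `C`-increasing there. -/
def CDecreasingAt {X Y : Type*} [PseudoMetricSpace X] [SeminormedAddCommGroup Y]
    (g : X → Y) (C : Set Y) (x₀ : X) : Prop :=
  CIncreasingAt (fun x => ({-g x} : Set Y)) C x₀

/-- The constant `α̲_{f,C,R}` of a parameterized vector optimization problem. -/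
noncomputable def alphaUnder {P : Type*} {n m : ℕ}
    (f : P → EuclideanSpace ℝ (Fin n) → EuclideanSpace ℝ (Fin m))
    (Cm : P → Set (EuclideanSpace ℝ (Fin m)))
    (R : P → Set (EuclideanSpace ℝ (Fin n))) : ℝ≥0∞ :=
  ⨅ q ∈ {q : P × EuclideanSpace ℝ (Fin n) |
      q.2 ∈ R q.1 ∧ ¬ (f q.1 '' R q.1 - {f q.1 q.2} ⊆ Cm q.1)},
    decBound (f q.1) (Cm q.1) q.2

/-- Moving away from a closed convex set along the projection direction increases the distance
at unit rate. -/
lemma exists_dist_le_infDist_add_le {Y : Type*} [NormedAddCommGroup Y] [InnerProductSpace ℝ Y]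
    [ProperSpace Y] {C : Set Y} (hC : IsClosed C) (hconv : Convex ℝ C) (hne : C.Nonempty)
    {b : Y} (hb : b ∉ C) {t : ℝ} (ht : 0 ≤ t) :
    ∃ b', dist b' b ≤ t ∧ infDist b C + t ≤ infDist b' C := by
  obtain ⟨c, hc, hbc⟩ := hC.exists_infDist_eq_dist hne b
  have hpos : 0 < ‖b - c‖ := norm_pos_iff.2 (sub_ne_zero.2 fun h => hb (h ▸ hc))
  have hproj : ∀ w ∈ C, inner ℝ (b - c) (w - c) ≤ 0 := by
    refine (norm_eq_iInf_iff_real_inner_le_zero hconv hc).1 ?_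
    rw [← dist_eq_norm, ← hbc, infDist_eq_iInf]
    simp only [dist_eq_norm]
  set v := ‖b - c‖⁻¹ • (b - c) with hv
  have hv1 : ‖v‖ = 1 := by
    rw [hv, norm_smul, norm_inv, norm_norm, inv_mul_cancel₀ hpos.ne']
  refine ⟨b + t • v, ?_, (le_infDist hne).2 fun w hw => ?_⟩
  · rw [dist_eq_norm, add_sub_cancel_left, norm_smul, hv1, mul_one, Real.norm_of_nonneg ht]
  · have hvw : inner ℝ v (w - c) ≤ 0 := by
      rw [hv, real_inner_smul_left]
      exact mul_nonpos_of_nonneg_of_nonpos (inv_nonneg.2 hpos.le) (hproj w hw)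
    have hvb : inner ℝ v (b - c) = ‖b - c‖ := by
      rw [hv, real_inner_smul_left, real_inner_self_eq_norm_sq]
      field_simp
    have hvv : inner ℝ v (t • v) = t := by
      rw [real_inner_smul_right, real_inner_self_eq_norm_sq, hv1]; ring
    have hsplit : b + t • v - w = (b - c) + t • v - (w - c) := by abel
    calc infDist b C + t = ‖b - c‖ + t := by rw [hbc, dist_eq_norm]
      _ ≤ inner ℝ v (b + t • v - w) := by
        rw [hsplit, inner_sub_right, inner_add_right, hvb, hvv]; linarith
      _ ≤ ‖v‖ * ‖b + t • v - w‖ := real_inner_le_norm _ _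
      _ = dist (b + t • v) w := by rw [hv1, one_mul, dist_eq_norm]

lemma IsClosedConvexCone.add_mem {Y : Type*} [SeminormedAddCommGroup Y] [NormedSpace ℝ Y]
    {C : Set Y} (hC : IsClosedConvexCone C) {x y : Y} (hx : x ∈ C) (hy : y ∈ C) : x + y ∈ C := by
  obtain ⟨-, hconv, -, hsmul⟩ := hC
  have h := hsmul _ (hconv hx hy (by norm_num : (0 : ℝ) ≤ 1 / 2) (by norm_num : (0 : ℝ) ≤ 1 / 2)
    (by norm_num)) 2 (by norm_num)
  simpa [smul_add, smul_smul] using h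

lemma IsClosedConvexCone.infDist_add_le {Y : Type*} [SeminormedAddCommGroup Y] [NormedSpace ℝ Y]
    {C : Set Y} (hC : IsClosedConvexCone C) {c : Y} (hc : c ∈ C) (y : Y) :
    infDist (y + c) C ≤ infDist y C :=
  (le_infDist ⟨0, hC.2.2.1⟩).2 fun w hw =>
    (infDist_le_dist_of_mem (hC.add_mem hw hc)).trans_eq (dist_add_right y w c)

/-- A Caristi-type principle for continuous functions on proper spaces. -/
lemma exists_eq_zero_of_forall_exists_decrease {X : Type*} [PseudoMetricSpace X] [ProperSpace X]
    {φ : X → ℝ} (hφ : Continuous φ) (hφ0 : ∀ x, 0 ≤ φ x) {κ : ℝ} (hκ : 0 < κ)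
    (hdec : ∀ x, φ x ≠ 0 → ∃ z, φ z < φ x ∧ φ z + κ * dist x z ≤ φ x) (x₀ : X) :
    ∃ x, φ x = 0 ∧ κ * dist x₀ x ≤ φ x₀ := by
  set K := {x | φ x + κ * dist x₀ x ≤ φ x₀} with hK
  have hclosed : IsClosed K := isClosed_le (by fun_prop) continuous_const
  have hcompact : IsCompact K := by
    refine (isCompact_closedBall x₀ (φ x₀ / κ)).of_isClosed_subset hclosed fun x hx => ?_
    rw [Metric.mem_closedBall, dist_comm, le_div_iff₀ hκ, mul_comm]
    have := hφ0 x
    have hx' : φ x + κ * dist x₀ x ≤ φ x₀ := hx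
    linarith
  obtain ⟨x, hxK, hmin⟩ := hcompact.exists_isMinOn ⟨x₀, by simp [hK]⟩ hφ.continuousOn
  have hx : φ x + κ * dist x₀ x ≤ φ x₀ := hxK
  refine ⟨x, ?_, by linarith [hφ0 x]⟩
  by_contra hne
  obtain ⟨z, hlt, hz⟩ := hdec x hne
  have hzK : z ∈ K := by
    have := mul_le_mul_of_nonneg_left (dist_triangle x₀ x z) hκ.le
    change φ z + κ * dist x₀ z ≤ φ x₀
    linarith
  exact absurd (hmin hzK) (not_le.2 hlt)

/-- Real-valued excess of the translate `S - y` beyond `C`. -/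
noncomputable def translateExcess {Y : Type*} [SeminormedAddCommGroup Y] (S C : Set Y) (y : Y) :
    ℝ :=
  ⨆ s : S, infDist ((s : Y) - y) C

section translateExcess

variable {Y : Type*} [SeminormedAddCommGroup Y] {S C : Set Y}

lemma infDist_sub_le_infDist_sub_add (s y y' : Y) :
    infDist (s - y) C ≤ infDist (s - y') C + dist y y' := by
  rw [← dist_sub_left s y y']
  exact infDist_le_infDist_add_dist

lemma bddAbove_infDist_sub (hC : (0 : Y) ∈ C) (hS : Bornology.IsBounded (S \ C)) (y : Y) :
    BddAbove (range fun s : S => infDist ((s : Y) - y) C) := by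
  obtain ⟨M, hM⟩ := hS.exists_norm_le
  refine ⟨max M 0 + dist y 0, ?_⟩
  rintro _ ⟨⟨s, hs⟩, rfl⟩
  have h : infDist s C ≤ max M 0 := by
    by_cases hsC : s ∈ C
    · simp [infDist_zero_of_mem hsC]
    · exact (infDist_le_dist_of_mem hC).trans
        ((dist_zero_right s).trans_le ((hM s ⟨hs, hsC⟩).trans (le_max_left _ _)))
  have h' := infDist_sub_le_infDist_sub_add (C := C) s y 0
  rw [sub_zero] at h'
  exact h'.trans (by gcongr)

lemma translateExcess_nonneg (y : Y) : 0 ≤ translateExcess S C y :=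
  Real.iSup_nonneg fun _ => infDist_nonneg

lemma infDist_sub_le_translateExcess (hC : (0 : Y) ∈ C) (hS : Bornology.IsBounded (S \ C))
    {s : Y} (hs : s ∈ S) (y : Y) : infDist (s - y) C ≤ translateExcess S C y :=
  le_ciSup (bddAbove_infDist_sub hC hS y) ⟨s, hs⟩

lemma translateExcess_le_add_dist (hC : (0 : Y) ∈ C) (hS : Bornology.IsBounded (S \ C))
    (y y' : Y) : translateExcess S C y ≤ translateExcess S C y' + dist y y' :=
  Real.iSup_le (fun s => (infDist_sub_le_infDist_sub_add _ y y').trans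
    (by gcongr; exact infDist_sub_le_translateExcess hC hS s.2 y'))
    (add_nonneg (translateExcess_nonneg _) dist_nonneg)

lemma continuous_translateExcess (hC : (0 : Y) ∈ C) (hS : Bornology.IsBounded (S \ C)) :
    Continuous (translateExcess S C) :=
  (LipschitzWith.of_le_add fun y y' => translateExcess_le_add_dist hC hS y y').continuous

lemma sub_singleton_subset_of_translateExcess_eq_zero (hcl : IsClosed C) (hC : (0 : Y) ∈ C)
    (hS : Bornology.IsBounded (S \ C)) {y : Y} (h : translateExcess S C y = 0) :
    S - {y} ⊆ C := by
  rintro _ ⟨s, hs, _, rfl, rfl⟩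
  refine (hcl.mem_iff_infDist_zero ⟨0, hC⟩).2 (le_antisymm ?_ infDist_nonneg)
  exact (infDist_sub_le_translateExcess hC hS hs _).trans_eq h

lemma translateExcess_eq_zero_of_sub_singleton_subset {y : Y} (h : S - {y} ⊆ C) :
    translateExcess S C y = 0 :=
  le_antisymm (Real.iSup_le (fun s => (infDist_zero_of_mem
    (h (sub_mem_sub s.2 (mem_singleton y)))).le) le_rfl) (translateExcess_nonneg y)

lemma ofReal_translateExcess_le_excess (S C : Set Y) (y : Y) :
    ENNReal.ofReal (translateExcess S C y) ≤ excess (S - {y}) C := by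
  by_cases htop : excess (S - {y}) C = ∞
  · exact le_top.trans_eq htop.symm
  refine ENNReal.ofReal_le_of_le_toReal (Real.iSup_le (fun s => ?_) ENNReal.toReal_nonneg)
  exact ENNReal.toReal_mono htop
    (le_iSup₂_of_le ((s : Y) - y) (sub_mem_sub s.2 (mem_singleton y)) le_rfl)

end translateExcess

/-- If enlarging `-y'` by `t` stays in the `r`-enlargement of `-y + C`, then the excess at `y'` is
smaller than the excess at `y` by `t - r`, unless `S - y'` is contained in `C`. -/
lemma translateExcess_add_le {Y : Type*} [NormedAddCommGroup Y] [InnerProductSpace ℝ Y]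
    [ProperSpace Y] {S C : Set Y} (hC : IsClosedConvexCone C)
    (hS : Bornology.IsBounded (S \ C)) {y y' : Y} {t r : ℝ} (ht : 0 ≤ t) (hr : 0 ≤ r)
    (hsub : cthickening t ({-y'} : Set Y) ⊆ cthickening r ({-y} + C))
    (hnot : ∃ s ∈ S, s - y' ∉ C) :
    translateExcess S C y' + t ≤ translateExcess S C y + r := by
  have hC0 := hC.2.2.1
  have key : ∀ s ∈ S, s - y' ∉ C → infDist (s - y') C + t ≤ translateExcess S C y + r := by
    intro s hs hsC
    obtain ⟨b, hbd, hb⟩ := exists_dist_le_infDist_add_le hC.1 hC.2.1 ⟨0, hC0⟩ hsC ht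
    have hmem : b - s ∈ cthickening r ({-y} + C) := by
      refine hsub (mem_cthickening_of_dist_le _ (-y') _ _ (mem_singleton _) ?_)
      rw [dist_eq_norm] at hbd ⊢
      rwa [show b - s - -y' = b - (s - y') by abel]
    have hne : ({-y} + C : Set Y).Nonempty := (singleton_nonempty _).add ⟨0, hC0⟩
    have hr' : infDist (b - s) ({-y} + C) ≤ r := by
      rw [mem_cthickening_iff] at hmem
      exact ENNReal.toReal_le_of_le_ofReal hr hmem
    have hle : infDist b C - translateExcess S C y ≤ infDist (b - s) ({-y} + C) := by
      refine (le_infDist hne).2 ?_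
      rintro _ ⟨_, rfl, c, hc, rfl⟩
      have h1 := infDist_le_infDist_add_dist (s := C) (x := b) (y := s - y + c)
      have h2 := hC.infDist_add_le hc (s - y)
      have h3 := infDist_sub_le_translateExcess hC0 hS hs y
      have h4 : dist (b - s) (-y + c) = dist b (s - y + c) := by
        rw [dist_eq_norm, dist_eq_norm]; congr 1; abel
      change _ ≤ dist (b - s) (-y + c)
      linarith
    linarith
  obtain ⟨s₀, hs₀, hs₀C⟩ := hnot
  have h₀ := key s₀ hs₀ hs₀C
  have h₀' : 0 ≤ infDist (s₀ - y') C := infDist_nonneg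
  rw [← le_sub_iff_add_le]
  refine Real.iSup_le (fun s => ?_) (by linarith)
  by_cases hsC : (s : Y) - y' ∈ C
  · rw [infDist_zero_of_mem hsC]; linarith
  · linarith [key s s.2 hsC]

/-- Decrease of the excess at a point where `g` is metrically `C`-decreasing. -/
lemma exists_translateExcess_decrease {X Y : Type*} [PseudoMetricSpace X]
    [NormedAddCommGroup Y] [InnerProductSpace ℝ Y] [ProperSpace Y] {g : X → Y}
    (hg : Continuous g) {S C : Set Y} (hC : IsClosedConvexCone C)
    (hS : Bornology.IsBounded (S \ C)) {x : X} (hx : ¬ (S - {g x} ⊆ C)) {a : ℝ} (ha : 0 ≤ a)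
    (hlt : ENNReal.ofReal a < decBound g C x) :
    ∃ r : ℝ, 0 < r ∧ ∃ u, dist x u ≤ r ∧
      translateExcess S C (g u) + (a - 1) * r ≤ translateExcess S C (g x) := by
  unfold decBound incBound at hlt
  simp only [lt_iSup_iff] at hlt
  obtain ⟨a', ⟨-, δ, hδ, hinc⟩, haa'⟩ := hlt
  have haa : a < a' := (ENNReal.ofReal_lt_ofReal_iff_of_nonneg ha).1 haa'
  obtain ⟨_, ⟨s, hs, _, rfl, rfl⟩, hsC⟩ := not_subset.1 hx
  have hev : ∀ᶠ u in 𝓝 x, s - g u ∈ Cᶜ :=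
    (continuous_const.sub hg).continuousAt.eventually (hC.1.isOpen_compl.mem_nhds hsC)
  obtain ⟨ε, hε, hball⟩ := Metric.nhds_basis_closedBall.eventually_iff.1 hev
  have hr : 0 < min δ ε := lt_min hδ hε
  obtain ⟨u, hu, hsub⟩ := hinc _ hr (min_le_left _ _)
  refine ⟨min δ ε, hr, u, by rwa [dist_comm], ?_⟩
  have h := translateExcess_add_le hC hS (mul_nonneg (ha.trans haa.le) hr.le) hr.le hsub
    ⟨s, hs, hball (closedBall_subset_closedBall (min_le_right _ _) hu)⟩
  nlinarith

/-- Outside a closed set, one can step towards the set. -/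
lemma exists_notMem_infDist_add_dist_le {X : Type*} [NormedAddCommGroup X] [NormedSpace ℝ X]
    [ProperSpace X] {R : Set X} (hne : R.Nonempty) (hR : IsClosed R) {x : X} (hx : x ∉ R) :
    ∃ z ∉ R, 0 < dist x z ∧ infDist z R + dist x z ≤ infDist x R := by
  obtain ⟨y, hy, hxy⟩ := hR.exists_infDist_eq_dist hne x
  have hpos : 0 < infDist x R := (hR.notMem_iff_infDist_pos hne).1 hx
  have hxz : dist x (midpoint ℝ x y) = infDist x R / 2 := by
    rw [dist_left_midpoint, ← hxy, Real.norm_ofNat]; ring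
  have hzy : dist (midpoint ℝ x y) y = infDist x R / 2 := by
    rw [dist_midpoint_right, ← hxy, Real.norm_ofNat]; ring
  refine ⟨midpoint ℝ x y, fun hz => ?_, by linarith, ?_⟩
  · have := infDist_le_dist_of_mem (x := x) hz
    linarith
  · have := infDist_le_dist_of_mem (x := midpoint ℝ x y) hy
    linarith

/-- Existence of ideal efficient points, with an error bound, for a single problem. -/
lemma exists_ideal_efficient {X Y : Type*} [NormedAddCommGroup X] [NormedSpace ℝ X]
    [ProperSpace X] [NormedAddCommGroup Y] [InnerProductSpace ℝ Y] [ProperSpace Y] {g : X → Y}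
    (hg : Continuous g) {R : Set X} (hne : R.Nonempty) (hR : IsClosed R) {C : Set Y}
    (hC : IsClosedConvexCone C) (hS : Bornology.IsBounded (g '' R \ C)) {ℓ a lam κ : ℝ}
    (hLip : ∀ x₁ ∉ R, ∀ x₂ ∉ R, dist (g x₁) (g x₂) ≤ ℓ * dist x₁ x₂) (ha : 0 ≤ a)
    (hdec : ∀ x ∈ R, ¬ (g '' R - {g x} ⊆ C) → ENNReal.ofReal a < decBound g C x)
    (hlam : 0 ≤ lam) (hκ : 0 < κ) (hκ₁ : κ ≤ lam - ℓ) (hκ₂ : κ ≤ a - 1 - lam) (x₀ : X) :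
    ∃ x ∈ {x | x ∈ R ∧ g '' R - {g x} ⊆ C},
      κ * dist x₀ x ≤ translateExcess (g '' R) C (g x₀) + lam * infDist x₀ R := by
  have hC0 := hC.2.2.1
  set φ : X → ℝ := fun x => translateExcess (g '' R) C (g x) + lam * infDist x R with hφ
  have hcont : Continuous φ := ((continuous_translateExcess hC0 hS).comp hg).add
    (continuous_const.mul (continuous_infDist_pt R))
  have hnn : ∀ x, 0 ≤ φ x := fun x =>
    add_nonneg (translateExcess_nonneg _) (mul_nonneg hlam infDist_nonneg)
  have hstep : ∀ x, ¬ (x ∈ R ∧ g '' R - {g x} ⊆ C) →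
      ∃ z, φ z < φ x ∧ φ z + κ * dist x z ≤ φ x := by
    intro x hx
    by_cases hxR : x ∈ R
    · have hxC : ¬ (g '' R - {g x} ⊆ C) := fun h => hx ⟨hxR, h⟩
      obtain ⟨r, hr, u, hu, hdecr⟩ :=
        exists_translateExcess_decrease hg hC hS hxC ha (hdec x hxR hxC)
      have hu' : infDist u R ≤ r := (infDist_le_dist_of_mem hxR).trans (by rwa [dist_comm])
      have h1 := mul_le_mul_of_nonneg_left hu' hlam
      have h2 := mul_le_mul_of_nonneg_right hκ₂ hr.le
      have h3 := mul_le_mul_of_nonneg_left hu hκ.le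
      have h4 := mul_pos hκ hr
      have h5 : φ x = translateExcess (g '' R) C (g x) := by
        simp [hφ, infDist_zero_of_mem hxR]
      have h6 : φ u + κ * r ≤ φ x := by
        rw [h5]; simp only [hφ]; linarith
      exact ⟨u, by linarith, by linarith⟩
    · obtain ⟨z, hzR, hpos, hz⟩ := exists_notMem_infDist_add_dist_le hne hR hxR
      have h1 := translateExcess_le_add_dist hC0 hS (g z) (g x)
      have h2 := hLip z hzR x hxR
      rw [dist_comm z x] at h2
      have h3 := mul_le_mul_of_nonneg_left hz hlam
      have h4 := mul_le_mul_of_nonneg_right hκ₁ hpos.le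
      have h5 : φ z + κ * dist x z ≤ φ x := by simp only [hφ]; linarith
      exact ⟨z, by linarith [mul_pos hκ hpos], h5⟩
  obtain ⟨x, hx0, hxd⟩ := exists_eq_zero_of_forall_exists_decrease hcont hnn hκ
    (fun x hx => hstep x fun h => hx (by
      simp [hφ, infDist_zero_of_mem h.1, translateExcess_eq_zero_of_sub_singleton_subset h.2])) x₀
  refine ⟨x, ?_, hxd⟩
  by_contra hx
  obtain ⟨z, hz, -⟩ := hstep x hx
  linarith [hnn z]

/-- Global ideal solvability of parameterized vector optimization problems, with the
associated error bound. -/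
theorem stmt16 {P : Type*} [TopologicalSpace P] {n m : ℕ}
    (f : P → EuclideanSpace ℝ (Fin n) → EuclideanSpace ℝ (Fin m))
    (R : P → Set (EuclideanSpace ℝ (Fin n)))
    (Cm : P → Set (EuclideanSpace ℝ (Fin m)))
    (hR : ∀ p, (R p).Nonempty ∧ IsClosed (R p))
    (hCm : ∀ p, IsClosedConvexCone (Cm p) ∧ Cm p ∩ -Cm p = {0} ∧
      ({0} : Set (EuclideanSpace ℝ (Fin m))) ≠ Cm p ∧ Cm p ≠ Set.univ)
    (hi : ∀ p, IsClosed (f p '' R p) ∧ Bornology.IsBounded (f p '' R p \ Cm p))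
    (hii : 1 < alphaUnder f Cm R)
    (ℓf : ℝ) (hℓfpos : 0 < ℓf)
    (hℓflt : ENNReal.ofReal ℓf < alphaUnder f Cm R - 1)
    (hiii : ∀ p, Continuous (f p) ∧
      ∀ x₁ ∉ R p, ∀ x₂ ∉ R p, dist (f p x₁) (f p x₂) ≤ ℓf * dist x₁ x₂) :
    (∀ p, {x | x ∈ R p ∧ f p '' R p - {f p x} ⊆ Cm p}.Nonempty) ∧
    ∀ α : ℝ,
      (alphaUnder f Cm R - ENNReal.ofReal ℓf + 1) / 2 < ENNReal.ofReal α →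
      ENNReal.ofReal α < alphaUnder f Cm R - ENNReal.ofReal ℓf →
      ∀ (x₀ : EuclideanSpace ℝ (Fin n)) (p : P),
        EMetric.infEdist x₀ {x | x ∈ R p ∧ f p '' R p - {f p x} ⊆ Cm p} ≤
          (excess (f p '' R p - {f p x₀}) (Cm p) +
              (alphaUnder f Cm R - ENNReal.ofReal α) * EMetric.infEdist x₀ (R p)) /
            (alphaUnder f Cm R - ENNReal.ofReal α - ENNReal.ofReal ℓf) := by
  have hdec : ∀ p (a : ℝ), ENNReal.ofReal a < alphaUnder f Cm R → ∀ x ∈ R p,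
      ¬ (f p '' R p - {f p x} ⊆ Cm p) → ENNReal.ofReal a < decBound (f p) (Cm p) x :=
    fun p a ha x hx hxC => ha.trans_le (iInf₂_le (p, x) ⟨hx, hxC⟩)
  constructor
  · intro p
    obtain ⟨b, hb₁, hb₂⟩ := ENNReal.lt_iff_exists_nnreal_btwn.1 (lt_tsub_iff_right.1 hℓflt)
    have hb : ℓf + 1 < (b : ℝ) := by
      rw [← ENNReal.ofReal_one, ← ENNReal.ofReal_add hℓfpos.le zero_le_one,
        ← ENNReal.ofReal_coe_nnreal] at hb₁
      exact (ENNReal.ofReal_lt_ofReal_iff_of_nonneg (by linarith)).1 hb₁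
    obtain ⟨x, hx, -⟩ := exists_ideal_efficient (hiii p).1 (hR p).1 (hR p).2 (hCm p).1 (hi p).2
      (hiii p).2 (a := (b : ℝ)) b.2 (hdec p b (by simpa using hb₂)) (lam := (b - 1 + ℓf) / 2)
      (κ := (b - 1 - ℓf) / 2) (by linarith) (by linarith) (by linarith) (by linarith)
      (hR p).1.some
    exact ⟨x, hx⟩
  · intro α hα₁ hα₂ x₀ p
    have htop : alphaUnder f Cm R ≠ ∞ := by
      intro h
      simp [h, ENNReal.top_div] at hα₁
    obtain ⟨A, hA0, hA⟩ : ∃ A : ℝ, 0 ≤ A ∧ alphaUnder f Cm R = ENNReal.ofReal A :=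
      ⟨_, ENNReal.toReal_nonneg, (ENNReal.ofReal_toReal htop).symm⟩
    have hdecA := hdec p
    rw [hA] at hα₁ hα₂ hℓflt hdecA ⊢
    have hAℓ : ℓf + 1 < A := by
      rw [← ENNReal.ofReal_one, ← ENNReal.ofReal_sub _ zero_le_one,
        ENNReal.ofReal_lt_ofReal_iff_of_nonneg hℓfpos.le] at hℓflt
      linarith
    have hα0 : 0 < α := ENNReal.ofReal_pos.1 (bot_le.trans_lt hα₁)
    have h2 : A - ℓf + 1 < 2 * α := by
      rw [← ENNReal.ofReal_sub _ hℓfpos.le, ← ENNReal.ofReal_one,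
        ← ENNReal.ofReal_add (by linarith) zero_le_one, ← ENNReal.ofReal_ofNat 2,
        ← ENNReal.ofReal_div_of_pos (by norm_num),
        ENNReal.ofReal_lt_ofReal_iff hα0] at hα₁
      linarith
    have h3 : α < A - ℓf := by
      rwa [← ENNReal.ofReal_sub _ hℓfpos.le,
        ENNReal.ofReal_lt_ofReal_iff_of_nonneg hα0.le] at hα₂
    have hκ : 0 < A - α - ℓf := by linarith
    obtain ⟨x, hx, hxd⟩ := exists_ideal_efficient (hiii p).1 (hR p).1 (hR p).2 (hCm p).1 (hi p).2
      (hiii p).2 (a := 1 + 2 * (A - α) - ℓf) (by linarith)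
      (hdecA _ ((ENNReal.ofReal_lt_ofReal_iff (by linarith)).2 (by linarith)))
      (lam := A - α) (κ := A - α - ℓf) (by linarith) hκ le_rfl (by linarith) x₀
    rw [← ENNReal.ofReal_sub _ hα0.le, ← ENNReal.ofReal_sub _ hℓfpos.le,
      ENNReal.le_div_iff_mul_le (Or.inl (ENNReal.ofReal_pos.2 hκ).ne')
        (Or.inl ENNReal.ofReal_ne_top)]
    have hinf : Metric.infEDist x₀ (R p) = ENNReal.ofReal (infDist x₀ (R p)) :=
      (ENNReal.ofReal_toReal (infEDist_ne_top (hR p).1)).symm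
    calc Metric.infEDist x₀ {x | x ∈ R p ∧ f p '' R p - {f p x} ⊆ Cm p} *
          ENNReal.ofReal (A - α - ℓf)
        ≤ edist x₀ x * ENNReal.ofReal (A - α - ℓf) := by
          gcongr; exact Metric.infEDist_le_edist_of_mem hx
      _ = ENNReal.ofReal ((A - α - ℓf) * dist x₀ x) := by
          rw [edist_dist, ← ENNReal.ofReal_mul dist_nonneg, mul_comm]
      _ ≤ ENNReal.ofReal (translateExcess (f p '' R p) (Cm p) (f p x₀) +
            (A - α) * infDist x₀ (R p)) := ENNReal.ofReal_le_ofReal hxd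
      _ = ENNReal.ofReal (translateExcess (f p '' R p) (Cm p) (f p x₀)) +
            ENNReal.ofReal (A - α) * Metric.infEDist x₀ (R p) := by
          rw [ENNReal.ofReal_add (translateExcess_nonneg _)
            (mul_nonneg (by linarith) infDist_nonneg), ENNReal.ofReal_mul (by linarith), hinf]
      _ ≤ _ := by
          exact add_le_add_left (ofReal_translateExcess_le_excess _ _ _) _
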